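/- arXiv:0801.3260 — 3 statements merged into one kernel-verified Lean document; each statement's English description precedes it below -/
import Mathlib

section
/- Let (V, Y, c) be a vertex coalgebra over F and let D* = (Id_V ⊗ c)Δ_{-2}. Then (D* ⊗ Id_V)Y(x) = (d/dx)Y(x); equivalently, for every k ∈ ℤ and v ∈ V, (D* ⊗ Id_V)(Δ_k(v)) = −k · Δ_{k−1}(v). -/
/- Common background for the formalization of "Vertex coalgebras, comodules,
cocommutativity and coassociativity" (K. Hubbard).

A vertex coalgebra `(V, Y, c)` is encoded by the family of coefficient maps
`Δ k : V →ₗ V ⊗ V` of the coproduct `Y(x)v = ∑ₖ Δ k v · x^(-k-1)` together with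
the covacuum `c : V →ₗ F`.  All identities of formal series are encoded
coefficient-wise; in particular the Jacobi identity is encoded by its
(dual Borcherds) coefficient form. -/

noncomputable section

open scoped TensorProduct

variable (F : Type) [Field F] [CharZero F]

/-- The generalized binomial coefficient `(a choose i)` as an element of `F`. -/
def gchoose (a : ℤ) (i : ℕ) : F :=
  (∏ j ∈ Finset.range i, ((a : F) - (j : F))) / (Nat.factorial i : F)

variable {V M : Type} [AddCommGroup V] [Module F V] [AddCommGroup M] [Module F M]

/-- `c ⊗ Id` composed with the canonical identification `F ⊗ M ≃ M`. -/
def cLeft (c : V →ₗ[F] F) : V ⊗[F] M →ₗ[F] M :=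
  (TensorProduct.lid F M).toLinearMap ∘ₗ TensorProduct.map c LinearMap.id

/-- `Id ⊗ c` composed with the canonical identification `V ⊗ F ≃ V`. -/
def cRight (c : M →ₗ[F] F) : V ⊗[F] M →ₗ[F] V :=
  (TensorProduct.rid F V).toLinearMap ∘ₗ TensorProduct.map LinearMap.id c

/-- The transposition `T ⊗ Id` of the first two tensor factors of `V ⊗ (V ⊗ M)`. -/
def Tfirst : V ⊗[F] (V ⊗[F] M) →ₗ[F] V ⊗[F] (V ⊗[F] M) :=
  (TensorProduct.assoc F V V M).toLinearMap ∘ₗ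
    TensorProduct.map (TensorProduct.comm F V V).toLinearMap LinearMap.id ∘ₗ
    (TensorProduct.assoc F V V M).symm.toLinearMap

/-- The coefficient of `x₁^(-m-1) x₂^(-n-1)` in `(Id ⊗ Y(x₂)) Y(x₁)`. -/
def comp12 (ΔM : ℤ → M →ₗ[F] V ⊗[F] M) (m n : ℤ) : M →ₗ[F] V ⊗[F] (V ⊗[F] M) :=
  TensorProduct.map LinearMap.id (ΔM n) ∘ₗ ΔM m

/-- The coefficient of `x₀^(-m-1) x₂^(-n-1)` in `(Y(x₀) ⊗ Id) Y(x₂)`. -/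
def compR (ΔV : ℤ → V →ₗ[F] V ⊗[F] V) (ΔM : ℤ → M →ₗ[F] V ⊗[F] M) (m n : ℤ) :
    M →ₗ[F] V ⊗[F] (V ⊗[F] M) :=
  (TensorProduct.assoc F V V M).toLinearMap ∘ₗ TensorProduct.map (ΔV m) LinearMap.id ∘ₗ ΔM n

/-- The coefficient form of the (comodule) Jacobi identity of a vertex coalgebra,
obtained by extracting the coefficient of `x₀^(-a-1) x₁^(-b-1) x₂^(-c-1)`. -/
def JacobiId (ΔV : ℤ → V →ₗ[F] V ⊗[F] V) (ΔM : ℤ → M →ₗ[F] V ⊗[F] M) : Prop :=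
  ∀ (a b c : ℤ) (w : M),
    (∑ᶠ i : ℕ, ((-1 : F) ^ i * gchoose F a i) •
        (comp12 F ΔM (a + b - i) (c + i) w -
          (-1 : F) ^ a • Tfirst F (comp12 F ΔM (a + c - i) (b + i) w))) =
      ∑ᶠ i : ℕ, gchoose F b i • compR F ΔV ΔM (a + i) (b + c - i) w

/-- The axioms of a vertex coalgebra except the Jacobi identity: left counit,
cocreation and truncation, in coefficient form. -/
def IsVertexCoalgSansJacobi (Δ : ℤ → V →ₗ[F] V ⊗[F] V) (c : V →ₗ[F] F) : Prop :=
  (∀ v : V, cLeft F c (Δ (-1) v) = v) ∧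
  (∀ k : ℤ, k ≠ -1 → ∀ v : V, cLeft F c (Δ k v) = 0) ∧
  (∀ v : V, cRight F c (Δ (-1) v) = v) ∧
  (∀ k : ℤ, 0 ≤ k → ∀ v : V, cRight F c (Δ k v) = 0) ∧
  (∀ v : V, ∃ N : ℤ, ∀ k : ℤ, k < N → Δ k v = 0)

/-- The axioms of a vertex coalgebra. -/
def IsVertexCoalg (Δ : ℤ → V →ₗ[F] V ⊗[F] V) (c : V →ₗ[F] F) : Prop :=
  IsVertexCoalgSansJacobi F Δ c ∧ JacobiId F Δ Δ

/-- The weight-`m` component of `V ⊗ V` for a graded space `V`. -/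
def grT2 (gr : ℤ → Submodule F V) (m : ℤ) : Submodule F (V ⊗[F] V) :=
  ⨆ p : ℤ, LinearMap.range (TensorProduct.map (gr p).subtype (gr (m - p)).subtype)

/-- The weight-`m` component of `V ⊗ (V ⊗ V)` for a graded space `V`. -/
def grT3 (gr : ℤ → Submodule F V) (m : ℤ) : Submodule F (V ⊗[F] (V ⊗[F] V)) :=
  ⨆ p : ℤ × ℤ, LinearMap.range (TensorProduct.map (gr p.1).subtype
    (TensorProduct.map (gr p.2).subtype (gr (m - p.1 - p.2)).subtype))

/-- The grading axioms of a graded vertex coalgebra: `V = ⊕ₖ V₍ₖ₎` internally,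
`V₍ₖ₎ = 0` for `k` sufficiently small, and `Δ k` raises weight by `k + 1`. -/
def IsGradedVC (Δ : ℤ → V →ₗ[F] V ⊗[F] V) (gr : ℤ → Submodule F V) : Prop :=
  DirectSum.IsInternal gr ∧ (∃ N : ℤ, ∀ k : ℤ, k < N → gr k = ⊥) ∧
  (∀ r k : ℤ, ∀ v ∈ gr r, Δ k v ∈ grT2 F gr (r + k + 1))

/-- `f` belongs to the graded dual `(V^{⊗3})'`: it vanishes on all but finitely
many homogeneous components of `V ⊗ V ⊗ V`. -/
def GradedDual3 (gr : ℤ → Submodule F V) (f : V ⊗[F] (V ⊗[F] V) →ₗ[F] F) : Prop :=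
  ∃ s : Finset ℤ, ∀ m : ℤ, m ∉ s → ∀ u ∈ grT3 F gr m, f u = 0

/-- The weight-`q` component of `V ⊗ M` for `V` a `ℤ`-graded space and
`M` a `ℚ`-graded space. -/
def grVM (gr : ℤ → Submodule F V) (grM : ℚ → Submodule F M) (q : ℚ) :
    Submodule F (V ⊗[F] M) :=
  ⨆ p : ℤ, LinearMap.range (TensorProduct.map (gr p).subtype (grM (q - p)).subtype)

/-- The weight-`q` component of `V ⊗ (V ⊗ M)`. -/
def grVVM (gr : ℤ → Submodule F V) (grM : ℚ → Submodule F M) (q : ℚ) :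
    Submodule F (V ⊗[F] (V ⊗[F] M)) :=
  ⨆ p : ℤ × ℤ, LinearMap.range (TensorProduct.map (gr p.1).subtype
    (TensorProduct.map (gr p.2).subtype (grM (q - p.1 - p.2)).subtype))

/-- `f` belongs to the graded dual `(V ⊗ V ⊗ M)'`. -/
def GradedDualVVM (gr : ℤ → Submodule F V) (grM : ℚ → Submodule F M)
    (f : V ⊗[F] (V ⊗[F] M) →ₗ[F] F) : Prop :=
  ∃ s : Finset ℚ, ∀ q : ℚ, q ∉ s → ∀ u ∈ grVVM F gr grM q, f u = 0

/-- The axioms of a comodule over a graded vertex coalgebra, except the Jacobi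
identity: left counit, truncation, internal `ℚ`-grading bounded below, and the
grading condition on the comodule coproduct. -/
def IsComoduleSansJacobi (c : V →ₗ[F] F) (ΔM : ℤ → M →ₗ[F] V ⊗[F] M)
    (gr : ℤ → Submodule F V) (grM : ℚ → Submodule F M) : Prop :=
  (∀ w : M, cLeft F c (ΔM (-1) w) = w) ∧
  (∀ k : ℤ, k ≠ -1 → ∀ w : M, cLeft F c (ΔM k w) = 0) ∧
  (∀ w : M, ∃ N : ℤ, ∀ k : ℤ, k < N → ΔM k w = 0) ∧
  DirectSum.IsInternal grM ∧ (∃ N : ℚ, ∀ q : ℚ, q < N → grM q = ⊥) ∧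
  (∀ (j : ℚ) (k : ℤ), ∀ w ∈ grM j, ΔM k w ∈ grVM F gr grM (j + k + 1))

/-- Weak cocommutativity with exponent `k`, paired against `f`, coefficient-wise:
the coefficient of `x₁^(-b-1) x₂^(-c-1)` in
`(x₁-x₂)^k ⟨f, (Id ⊗ Y(x₂))Y(x₁)w - (T ⊗ Id)(Id ⊗ Y(x₁))Y(x₂)w⟩` vanishes. -/
def WeakCocom (ΔM : ℤ → M →ₗ[F] V ⊗[F] M) (f : V ⊗[F] (V ⊗[F] M) →ₗ[F] F)
    (k : ℕ) : Prop :=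
  ∀ (w : M) (b c : ℤ),
    ∑ j ∈ Finset.range (k + 1), ((-1 : F) ^ j * (k.choose j : F)) *
      (f (comp12 F ΔM (b + k - j) (c + j) w) -
        f (Tfirst F (comp12 F ΔM (c + j) (b + k - j) w))) = 0

/-- Weak coassociativity with exponent `k`, paired against `f`, coefficient-wise:
the coefficient of `x₀^(-a-1) x₂^(-c-1)` in
`(x₀+x₂)^k ⟨f, (Y(x₀) ⊗ Id)Y(x₂)w - (Id ⊗ Y(x₂))Y(x₀+x₂)w⟩` vanishes,
`Y(x₀+x₂)` being expanded in nonnegative integral powers of `x₂`. -/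
def WeakCoassoc (ΔV : ℤ → V →ₗ[F] V ⊗[F] V) (ΔM : ℤ → M →ₗ[F] V ⊗[F] M)
    (f : V ⊗[F] (V ⊗[F] M) →ₗ[F] F) (k : ℕ) : Prop :=
  ∀ (w : M) (a c : ℤ),
    ∑ j ∈ Finset.range (k + 1), (k.choose j : F) *
      (f (compR F ΔV ΔM (a + k - j) (c + j) w) -
        ∑ᶠ i : ℕ, ((-1 : F) ^ i * gchoose F (a + k - j) i) *
          f (comp12 F ΔM (a + k - j - i) (c + j + i) w)) = 0

/-- The coefficient function of `x^r y^s (x + ε y)^t · A`, where `A : ℤ → ℤ → F`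
is the coefficient function of a formal series (`A m n` is the coefficient of
`x^m y^n`). -/
def mulPoly (r s t : ℕ) (ε : F) (A : ℤ → ℤ → F) (m n : ℤ) : F :=
  ∑ j ∈ Finset.range (t + 1), (t.choose j : F) * ε ^ j *
    A (m - (r : ℤ) - ((t - j : ℕ) : ℤ)) (n - (s : ℤ) - (j : ℤ))

/-- `g` is the coefficient function of a polynomial in two variables. -/
def IsPolyCoeff (g : ℤ → ℤ → F) : Prop :=
  {p : ℤ × ℤ | g p.1 p.2 ≠ 0}.Finite ∧ ∀ m n : ℤ, m < 0 ∨ n < 0 → g m n = 0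

/-- The coefficient function of the polynomial `h(x₁ - x₂, x₂)` in the
variables `x₁, x₂`, given the coefficient function of `h = h(x₀, x₂)`. -/
def substC (h : ℤ → ℤ → F) (m n : ℤ) : F :=
  ∑ᶠ j : ℕ, ((-1 : F) ^ j * gchoose F (m + j) j) * h (m + j) (n - j)

/-- The coefficient form of the Jacobi identity of a vertex algebra (the
Borcherds identity). -/
def VAJacobi (mul : ℤ → V →ₗ[F] V →ₗ[F] V) : Prop :=
  ∀ (a b c : ℤ) (u v w : V),
    (∑ᶠ i : ℕ, ((-1 : F) ^ i * gchoose F a i) •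
        (mul (a + b - i) u (mul (c + i) v w) -
          (-1 : F) ^ a • mul (a + c - i) v (mul (b + i) u w))) =
      ∑ᶠ i : ℕ, gchoose F b i • mul (b + c - i) (mul (a + i) u v) w

/-- The axioms of a vertex algebra: truncation, vacuum, creation and the Jacobi
identity, in coefficient form (`mul n u v` is `u_n v`). -/
def IsVA (mul : ℤ → V →ₗ[F] V →ₗ[F] V) (one : V) : Prop :=
  (∀ u v : V, ∃ N : ℤ, ∀ n : ℤ, N < n → mul n u v = 0) ∧
  (∀ v : V, mul (-1) one v = v) ∧
  (∀ n : ℤ, n ≠ -1 → ∀ v : V, mul n one v = 0) ∧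
  (∀ v : V, mul (-1) v one = v) ∧
  (∀ n : ℤ, 0 ≤ n → ∀ v : V, mul n v one = 0) ∧
  VAJacobi F mul

/-- The graded dual `V' = ⊕ₖ V₍ₖ₎*`, realized as the submodule of the full dual
consisting of functionals vanishing on all but finitely many components. -/
def gradedDual (gr : ℤ → Submodule F V) : Submodule F (Module.Dual F V) where
  carrier := {φ | ∃ s : Finset ℤ, ∀ k ∉ s, ∀ u ∈ gr k, φ u = 0}
  zero_mem' := ⟨∅, by intro k _ u _; simp⟩
  add_mem' := by
    rintro a b ⟨s, hs⟩ ⟨t, ht⟩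
    refine ⟨s ∪ t, ?_⟩
    intro k hk u hu
    simp only [Finset.mem_union, not_or] at hk
    simp [LinearMap.add_apply, hs k hk.1 u hu, ht k hk.2 u hu]
  smul_mem' := by
    rintro r a ⟨s, hs⟩
    refine ⟨s, ?_⟩
    intro k hk u hu
    simp [LinearMap.smul_apply, hs k hk u hu]

/-- The weight-`k` component `V₍ₖ₎* ⊆ V'` of the graded dual: functionals
vanishing on every component of weight other than `k`. -/
def gradedDualPiece (gr : ℤ → Submodule F V) (k : ℤ) :
    Submodule F ↥(gradedDual F gr) where
  carrier := {φ | ∀ j : ℤ, j ≠ k → ∀ u ∈ gr j, (φ : Module.Dual F V) u = 0}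
  zero_mem' := by intro j _ u _; simp
  add_mem' := by
    intro a b ha hb j hj u hu
    simp [ha j hj u hu, hb j hj u hu]
  smul_mem' := by
    intro r a ha j hj u hu
    simp [ha j hj u hu]

/-- The natural pairing of `V' ⊗ V'` with `V ⊗ V`. -/
def pairVV (gr : ℤ → Submodule F V) :
    ↥(gradedDual F gr) ⊗[F] ↥(gradedDual F gr) →ₗ[F] Module.Dual F (V ⊗[F] V) :=
  TensorProduct.dualDistrib F V V ∘ₗ
    TensorProduct.map (gradedDual F gr).subtype (gradedDual F gr).subtype

/-- The covacuum map on the graded dual: evaluation at the vacuum. -/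
def covac (gr : ℤ → Submodule F V) (one : V) : ↥(gradedDual F gr) →ₗ[F] F :=
  LinearMap.applyₗ one ∘ₗ (gradedDual F gr).subtype

/-- A bilinear form `B` on `V` extended componentwise to `V ⊗ V`. -/
def formT2 (B : V →ₗ[F] V →ₗ[F] F) : V ⊗[F] V →ₗ[F] Module.Dual F (V ⊗[F] V) :=
  TensorProduct.dualDistrib F V V ∘ₗ TensorProduct.map B B

lemma gchoose_zero_left (i : ℕ) : gchoose F 0 i = if i = 0 then 1 else 0 := by
  rcases i with _ | i
  · simp [gchoose]
  · simp [gchoose, Finset.prod_range_succ']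

lemma gchoose_neg_two (i : ℕ) : gchoose F (-2) i = (-1 : F) ^ i * (i + 1) := by
  have key : ∏ j ∈ Finset.range i, (((-2 : ℤ) : F) - (j : F)) =
      (-1 : F) ^ i * (i + 1) * (Nat.factorial i : F) := by
    induction i with
    | zero => simp
    | succ n ih =>
      rw [Finset.prod_range_succ, ih, Nat.factorial_succ]
      push_cast
      ring
  rw [gchoose, key, mul_div_cancel_right₀ _ (by exact_mod_cast Nat.factorial_ne_zero i)]

/-- `Id ⊗ c ⊗ Id` composed with the canonical identification `V ⊗ (F ⊗ M) ≃ V ⊗ M`. -/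
def cMiddle (c : V →ₗ[F] F) : V ⊗[F] (V ⊗[F] M) →ₗ[F] V ⊗[F] M :=
  TensorProduct.map LinearMap.id (cLeft F c)

lemma cMiddle_comp12 (c : V →ₗ[F] F) (ΔM : ℤ → M →ₗ[F] V ⊗[F] M) (m n : ℤ) (w : M) :
    cMiddle F c (comp12 F ΔM m n w) =
      TensorProduct.map LinearMap.id (cLeft F c ∘ₗ ΔM n) (ΔM m w) := by
  simp only [cMiddle, comp12, LinearMap.comp_apply]
  rw [← LinearMap.comp_apply, ← TensorProduct.map_comp, LinearMap.id_comp]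

lemma cMiddle_Tfirst (c : V →ₗ[F] F) (u : V ⊗[F] (V ⊗[F] M)) :
    cMiddle F c (Tfirst F u) = cLeft F c u := by
  have h : cMiddle F c ∘ₗ Tfirst F = cLeft F (M := V ⊗[F] M) c := by
    ext x y z
    simp [cMiddle, Tfirst, cLeft]
  exact LinearMap.congr_fun h u

lemma cLeft_comp12 (c : V →ₗ[F] F) (ΔM : ℤ → M →ₗ[F] V ⊗[F] M) (m n : ℤ) (w : M) :
    cLeft F c (comp12 F ΔM m n w) = ΔM n (cLeft F c (ΔM m w)) := by
  have h : cLeft F c ∘ₗ TensorProduct.map LinearMap.id (ΔM n) = ΔM n ∘ₗ cLeft F c := by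
    ext x y
    simp [cLeft]
  exact LinearMap.congr_fun h (ΔM m w)

lemma cMiddle_compR (c : V →ₗ[F] F) (ΔV : ℤ → V →ₗ[F] V ⊗[F] V)
    (ΔM : ℤ → M →ₗ[F] V ⊗[F] M) (m n : ℤ) (w : M) :
    cMiddle F c (compR F ΔV ΔM m n w) =
      TensorProduct.map (cRight F c ∘ₗ ΔV m) LinearMap.id (ΔM n w) := by
  have h : cMiddle F c ∘ₗ (TensorProduct.assoc F V V M).toLinearMap =
      TensorProduct.map (cRight F c) LinearMap.id := by
    ext x y z
    simp [cMiddle, cLeft, cRight, TensorProduct.smul_tmul]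
  have h' := LinearMap.congr_fun h (TensorProduct.map (ΔV m) LinearMap.id (ΔM n w))
  simp only [LinearMap.comp_apply] at h'
  simp only [compR, LinearMap.comp_apply]
  rw [h', ← LinearMap.comp_apply, ← TensorProduct.map_comp, LinearMap.id_comp]

/-- For a vertex coalgebra `(V, Y, c)` with `D* = (Id ⊗ c)Δ₋₂`,
`(D* ⊗ Id)Y(x) = (d/dx)Y(x)`, i.e. `(D* ⊗ Id)(Δ k v) = -k • Δ (k-1) v`. -/
theorem Dstar_derivative
    (Δ : ℤ → V →ₗ[F] V ⊗[F] V) (c : V →ₗ[F] F)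
    (hVC : IsVertexCoalg F Δ c)
    (Dstar : V →ₗ[F] V) (hD : Dstar = cRight F c ∘ₗ Δ (-2)) :
    ∀ (k : ℤ) (v : V),
      TensorProduct.map Dstar LinearMap.id (Δ k v) = (-(k : F)) • Δ (k - 1) v := by
  intro k v
  obtain ⟨⟨hl1, hl0, -, -, htr⟩, hJ⟩ := hVC
  obtain ⟨N, hN⟩ := htr v
  have hc12 (m n : ℤ) : cMiddle F c (comp12 F Δ m n v) = if n = -1 then Δ m v else 0 := by
    rw [cMiddle_comp12]
    split_ifs with h
    · have : cLeft F c ∘ₗ Δ n = LinearMap.id := by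
        subst h
        exact LinearMap.ext hl1
      rw [this, TensorProduct.map_id, LinearMap.id_apply]
    · have : cLeft F c ∘ₗ Δ n = 0 := LinearMap.ext (hl0 n h)
      rw [this, TensorProduct.map_zero_right, LinearMap.zero_apply]
  have hT (m n : ℤ) :
      cMiddle F c (Tfirst F (comp12 F Δ m n v)) = if m = -1 then Δ n v else 0 := by
    rw [cMiddle_Tfirst, cLeft_comp12]
    split_ifs with h
    · rw [h, hl1]
    · rw [hl0 m h, map_zero]
  have hJ' := congrArg (cMiddle F c) (hJ (-2) 0 k v)
  rw [finsum_eq_single (fun i : ℕ => gchoose F 0 i • compR F Δ Δ (-2 + i) (0 + k - i) v) 0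
    (fun i hi => by simp [gchoose_zero_left, hi])] at hJ'
  have hfin : (Function.support fun i : ℕ => ((-1 : F) ^ i * gchoose F (-2) i) •
      (comp12 F Δ (-2 + 0 - i) (k + i) v -
        (-1 : F) ^ (-2 : ℤ) • Tfirst F (comp12 F Δ (-2 + k - i) (0 + i) v))).Finite := by
    refine (Set.finite_le_nat (-N + |k|).toNat).subset fun i hi => ?_
    by_contra hlt
    have hlt : (-N + |k|).toNat < i := not_le.mp hlt
    have hk := le_abs_self k
    have hk' := abs_nonneg k
    refine hi ?_
    simp [comp12, hN (-2 - i) (by omega), hN (-2 + k - i) (by omega)]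
  have hmap := (cMiddle F c).toAddMonoidHom.map_finsum hfin
  simp only [LinearMap.toAddMonoidHom_coe] at hmap
  rw [hmap] at hJ'
  have hterm (i : ℕ) : cMiddle F c (((-1 : F) ^ i * gchoose F (-2) i) •
      (comp12 F Δ (-2 + 0 - i) (k + i) v -
        (-1 : F) ^ (-2 : ℤ) • Tfirst F (comp12 F Δ (-2 + k - i) (0 + i) v))) =
      ((i : F) + 1) • ((if k + i = -1 then Δ (-2 + 0 - i) v else 0) -
        (if -2 + k - i = -1 then Δ (0 + i) v else 0)) := by
    have hsq : (-1 : F) ^ i * (-1 : F) ^ i = 1 := by rw [← mul_pow]; simp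
    have hz : (-1 : F) ^ (-2 : ℤ) = 1 := by simp
    rw [map_smul, map_sub, map_smul, hc12, hT, gchoose_neg_two, ← mul_assoc, hsq, one_mul,
      hz, one_smul]
  simp only [hterm] at hJ'
  have hR : cMiddle F c (gchoose F 0 0 • compR F Δ Δ (-2 + (0 : ℕ)) (0 + k - (0 : ℕ)) v) =
      TensorProduct.map Dstar LinearMap.id (Δ k v) := by
    rw [map_smul, cMiddle_compR, hD]
    simp [gchoose_zero_left]
  rw [hR] at hJ'
  rw [← hJ']
  rcases lt_trichotomy k 0 with hk | rfl | hk
  · obtain ⟨n, rfl⟩ : ∃ n : ℕ, k = -1 - n := ⟨(-1 - k).toNat, by omega⟩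
    rw [finsum_eq_single _ n fun i hi => by
      rw [if_neg (by omega), if_neg (by omega), sub_zero, smul_zero]]
    rw [if_pos (by omega), if_neg (by omega), sub_zero]
    congr 1
    · push_cast
      ring
    · congr 2
      ring
  · rw [finsum_eq_zero_of_forall_eq_zero fun i => by
      rw [if_neg (by omega), if_neg (by omega), sub_zero, smul_zero]]
    simp
  · obtain ⟨n, rfl⟩ : ∃ n : ℕ, k = n + 1 := ⟨(k - 1).toNat, by omega⟩
    rw [finsum_eq_single _ n fun i hi => by
      rw [if_neg (by omega), if_neg (by omega), sub_zero, smul_zero]]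
    rw [if_neg (by omega), if_pos (by omega), zero_sub, smul_neg, ← neg_smul]
    congr 1
    · push_cast
      ring
    · congr 2
      ring
end
end

section
/- (Skew-symmetry.) Let (V, Y, c) be a vertex coalgebra over F and let D* = (Id_V ⊗ c)Δ_{-2}. Then T Y(x) = Y(−x) e^{x D*} as formal series; equivalently, for every k ∈ ℤ and v ∈ V, T(Δ_k(v)) = Σ_{j≥0} (−1)^{k+j+1} Δ_{k+j}((D*)^j v)/j!, where in particular each such sum has only finitely many nonzero terms. -/
/- Common background for the formalization of "Vertex coalgebras, comodules,
cocommutativity and coassociativity" (K. Hubbard).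

A vertex coalgebra `(V, Y, c)` is encoded by the family of coefficient maps
`Δ k : V →ₗ V ⊗ V` of the coproduct `Y(x)v = ∑ₖ Δ k v · x^(-k-1)` together with
the covacuum `c : V →ₗ F`.  All identities of formal series are encoded
coefficient-wise; in particular the Jacobi identity is encoded by its
(dual Borcherds) coefficient form. -/

noncomputable section

open scoped TensorProduct

variable (F : Type) [Field F] [CharZero F]

variable {V M : Type} [AddCommGroup V] [Module F V] [AddCommGroup M] [Module F M]

set_option linter.unusedSectionVars false

theorem finite_support_of_eventually_zero {A : Type*} [Zero A] {f : ℕ → A} (B : ℤ)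
    (h : ∀ i : ℕ, B < (i : ℤ) → f i = 0) : (Function.support f).Finite := by
  refine (Set.finite_Iic B.toNat).subset fun i hi => ?_
  by_contra hlt
  exact hi (h i (by simp only [Set.mem_Iic] at hlt; omega))

theorem gchoose_neg_one (i : ℕ) :
    gchoose F (-1) i = (-1 : F) ^ i := by
  have h : ∏ j ∈ Finset.range i, (((-1 : ℤ) : F) - (j : F))
      = (-1 : F) ^ i * (Nat.factorial i : F) := by
    induction i with
    | zero => simp
    | succ n ih =>
      rw [Finset.prod_range_succ, ih, Nat.factorial_succ]
      push_cast
      ring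
  rw [gchoose, h, mul_div_assoc, div_self (Nat.cast_ne_zero.mpr i.factorial_ne_zero), mul_one]

theorem cLeft_map_id (c : V →ₗ[F] F) (f : V →ₗ[F] M) (x : V ⊗[F] V) :
    cLeft F c (TensorProduct.map LinearMap.id f x) = f (cLeft F c x) := by
  induction x with
  | zero => simp
  | tmul u v => simp [cLeft]
  | add x y hx hy => simp only [map_add, hx, hy]

theorem cRight_comm (c : V →ₗ[F] F) (x : V ⊗[F] V) :
    cRight F c (TensorProduct.comm F V V x) = cLeft F c x := by
  induction x with
  | zero => simp
  | tmul u v => simp [cLeft, cRight]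
  | add x y hx hy => simp only [map_add, hx, hy]

/-- Contracting the last factor of `V ⊗ (V ⊗ M)` commutes with `T ⊗ Id`. -/
theorem map_cRight_Tfirst (c : M →ₗ[F] F) (x : V ⊗[F] (V ⊗[F] M)) :
    TensorProduct.map LinearMap.id (cRight F c) (Tfirst F x) =
      TensorProduct.comm F V V (TensorProduct.map LinearMap.id (cRight F c) x) := by
  induction x with
  | zero => simp
  | add x y hx hy => simp only [map_add, hx, hy]
  | tmul u y =>
    induction y with
    | zero => simp
    | add x y hx hy => simp only [TensorProduct.tmul_add, map_add, hx, hy]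
    | tmul v w => simp [Tfirst, cRight, TensorProduct.smul_tmul']

/-- Contracting the last factor of `V ⊗ (V ⊗ M)` after reassociating. -/
theorem map_cRight_assoc (c : M →ₗ[F] F) (x : (V ⊗[F] V) ⊗[F] M) :
    TensorProduct.map LinearMap.id (cRight F c) (TensorProduct.assoc F V V M x) =
      cRight F c x := by
  induction x with
  | zero => simp
  | add x y hx hy => simp only [map_add, hx, hy]
  | tmul y w =>
    induction y with
    | zero => simp
    | add x y hx hy => simp only [TensorProduct.add_tmul, map_add, hx, hy]
    | tmul u v => simp [cRight]

theorem cRight_map_id (c : M →ₗ[F] F) {A B : Type} [AddCommGroup A] [Module F A]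
    [AddCommGroup B] [Module F B] (f : A →ₗ[F] B) (x : A ⊗[F] M) :
    cRight F c (TensorProduct.map f LinearMap.id x) = f (cRight F c x) := by
  induction x with
  | zero => simp
  | tmul u v => simp [cRight]
  | add x y hx hy => simp only [map_add, hx, hy]

theorem map_cRight_comp12 (Δ : ℤ → V →ₗ[F] V ⊗[F] V) (c : V →ₗ[F] F) (m n : ℤ) (w : V) :
    TensorProduct.map LinearMap.id (cRight F c) (comp12 F Δ m n w) =
      TensorProduct.map LinearMap.id (cRight F c ∘ₗ Δ n) (Δ m w) := by
  rw [comp12, LinearMap.comp_apply, ← LinearMap.comp_apply, ← TensorProduct.map_comp]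
  simp

theorem map_cRight_compR (Δ : ℤ → V →ₗ[F] V ⊗[F] V) (c : V →ₗ[F] F) (m n : ℤ) (w : V) :
    TensorProduct.map LinearMap.id (cRight F c) (compR F Δ Δ m n w) =
      Δ m (cRight F c (Δ n w)) := by
  simp only [compR, LinearMap.comp_apply, LinearEquiv.coe_coe]
  rw [map_cRight_assoc, cRight_map_id]

/-- The Jacobi identity, at the power `x₂⁻¹`, with the covacuum applied to the last factor. -/
theorem jacobi_contract (Δ : ℤ → V →ₗ[F] V ⊗[F] V) (c : V →ₗ[F] F)
    (hVC : IsVertexCoalg F Δ c) (a b : ℤ) (w : V) :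
    (∑ᶠ i : ℕ, -(((-1 : F) ^ i * gchoose F a i * (-1 : F) ^ a) •
        TensorProduct.comm F V V
          (TensorProduct.map LinearMap.id (cRight F c ∘ₗ Δ (b + i)) (Δ (a - i) w)))) =
      ∑ᶠ i : ℕ, gchoose F b i • Δ (a + i) (cRight F c (Δ (b - i) w)) := by
  obtain ⟨⟨-, -, -, hpos, htr⟩, hJ⟩ := hVC
  obtain ⟨N, hN⟩ := htr w
  have key := congrArg (TensorProduct.map LinearMap.id (cRight F c)) (hJ a b 0 w)
  rw [map_finsum, map_finsum] at key
  · simp only [map_smul, map_sub, map_cRight_Tfirst, map_cRight_comp12, map_cRight_compR,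
      zero_add, add_zero] at key
    rw [← key]
    refine finsum_congr fun i => ?_
    have h0 : cRight F c ∘ₗ Δ (i : ℤ) = 0 := LinearMap.ext fun v => hpos _ (by omega) v
    rw [h0, TensorProduct.map_zero_right, LinearMap.zero_apply, zero_sub, smul_neg, smul_smul]
  · refine finite_support_of_eventually_zero (b - N) fun i hi => ?_
    simp [compR, hN (b - i) (by omega)]
  · refine finite_support_of_eventually_zero (max (a + b - N) (a - N)) fun i hi => ?_
    simp [comp12, hN (a + b - i) (by omega), hN (a - i) (by omega)]

theorem Dstar_cRight (Δ : ℤ → V →ₗ[F] V ⊗[F] V) (c : V →ₗ[F] F)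
    (hVC : IsVertexCoalg F Δ c) (b : ℤ) (w : V) :
    cRight F c (Δ (-2) (cRight F c (Δ b w))) = -((b : F) • cRight F c (Δ (b - 1) w)) := by
  have key := congrArg (cRight F c) (jacobi_contract F Δ c hVC (-2) b w)
  obtain ⟨⟨-, hleft, hone, hpos, htr⟩, -⟩ := hVC
  obtain ⟨N, hN⟩ := htr w
  rw [map_finsum, map_finsum] at key
  · simp only [map_neg, map_smul, cRight_comm, cLeft_map_id] at key
    rw [finsum_eq_zero_of_forall_eq_zero, finsum_eq_sum_of_support_subset (s := Finset.range 2)]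
      at key
    · simp only [Finset.sum_range_succ, Finset.sum_range_zero] at key
      norm_num [gchoose, hone] at key
      exact eq_neg_of_add_eq_zero_left key.symm
    · intro i hi
      by_contra hlt
      refine hi ?_
      have : 0 ≤ (-2 : ℤ) + i := by
        simp only [Finset.coe_range, Set.mem_Iio] at hlt
        omega
      simp [hpos _ this]
    · intro i
      simp [hleft (-2 - i) (by omega)]
  · refine finite_support_of_eventually_zero (b - N) fun i hi => ?_
    simp [hN (b - i) (by omega)]
  · refine finite_support_of_eventually_zero (-2 - N) fun i hi => ?_
    simp [hN (-2 - i) (by omega)]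

/-- The creation series `(Id ⊗ c) Y(x)` is `e^{x D*}`. -/
theorem cRight_eq_Dstar_pow (Δ : ℤ → V →ₗ[F] V ⊗[F] V) (c : V →ₗ[F] F)
    (hVC : IsVertexCoalg F Δ c) (j : ℕ) (w : V) :
    cRight F c (Δ (-1 - j) w) =
      (Nat.factorial j : F)⁻¹ • ((cRight F c ∘ₗ Δ (-2)) ^ j) w := by
  induction j with
  | zero => simp [hVC.1.2.2.1]
  | succ n ih =>
    have h := Dstar_cRight F Δ c hVC (-1 - n) w
    rw [ih, map_smul, map_smul] at h
    have hn : ((n : F) + 1) ≠ 0 := Nat.cast_add_one_ne_zero n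
    have hidx : (-1 - ((n + 1 : ℕ) : ℤ)) = -1 - n - 1 := by push_cast; ring
    have hcoef : (((-1 - n : ℤ)) : F) = -((n : F) + 1) := by push_cast; ring
    rw [hcoef, neg_smul, neg_neg] at h
    rw [hidx, pow_succ', Module.End.mul_apply, LinearMap.comp_apply, Nat.factorial_succ,
      Nat.cast_mul, mul_inv, mul_smul, h, smul_smul, Nat.cast_succ, inv_mul_cancel₀ hn, one_smul]

/-- Skew-symmetry: For a vertex coalgebra `(V, Y, c)` with
`D* = (Id ⊗ c)Δ₋₂`, `T Y(x) = Y(-x) e^{x D*}`: for every `k` and `v`,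
`T (Δ k v) = ∑_{j ≥ 0} (-1)^(k+j+1) Δ (k+j) ((D*)^j v) / j!`, where each such
sum has only finitely many nonzero terms. -/
theorem skew_symmetry
    (Δ : ℤ → V →ₗ[F] V ⊗[F] V) (c : V →ₗ[F] F)
    (hVC : IsVertexCoalg F Δ c)
    (Dstar : V →ₗ[F] V) (hD : Dstar = cRight F c ∘ₗ Δ (-2)) :
    ∀ (k : ℤ) (v : V),
      (Function.support fun j : ℕ =>
          ((-1 : F) ^ (k + j + 1) * (Nat.factorial j : F)⁻¹) •
            Δ (k + j) ((Dstar ^ j) v)).Finite ∧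
      (TensorProduct.comm F V V) (Δ k v) =
        ∑ᶠ j : ℕ, ((-1 : F) ^ (k + j + 1) * (Nat.factorial j : F)⁻¹) •
          Δ (k + j) ((Dstar ^ j) v) := by
  intro k v
  subst hD
  have hE := cRight_eq_Dstar_pow F Δ c hVC
  have hJ := jacobi_contract F Δ c hVC k (-1) v
  obtain ⟨⟨-, -, hone, hpos, htr⟩, -⟩ := hVC
  obtain ⟨N, hN⟩ := htr v
  have hterm (j : ℕ) : ((-1 : F) ^ (k + j + 1) * (Nat.factorial j : F)⁻¹) •
      Δ (k + j) (((cRight F c ∘ₗ Δ (-2)) ^ j) v) =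
      (-1 : F) ^ (k + j + 1) • Δ (k + j) (cRight F c (Δ (-1 - j) v)) := by
    rw [hE, map_smul, smul_smul]
  have hneg : (-1 : F) ≠ 0 := neg_ne_zero.mpr one_ne_zero
  simp only [hterm]
  refine ⟨finite_support_of_eventually_zero (-1 - N) fun j hj => ?_, ?_⟩
  · simp [hN (-1 - j) (by omega)]
  have hsign (j : ℕ) : (-1 : F) ^ (k + j + 1) • Δ (k + j) (cRight F c (Δ (-1 - j) v)) =
      (-(-1 : F) ^ k) • (gchoose F (-1) j • Δ (k + j) (cRight F c (Δ (-1 - j) v))) := by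
    rw [gchoose_neg_one, smul_smul, zpow_add₀ hneg, zpow_add₀ hneg, zpow_natCast, zpow_one]
    congr 1
    ring
  have hid : cRight F c ∘ₗ Δ (-1) = LinearMap.id := LinearMap.ext hone
  rw [finsum_congr hsign, ← smul_finsum, ← hJ, finsum_eq_single _ 0]
  · have hsq : (-1 : F) ^ k * (-1 : F) ^ k = 1 := by
      rw [← mul_zpow]; simp
    simp [gchoose, hid, smul_smul, hsq]
  · intro i hi
    have h0 : cRight F c ∘ₗ Δ (-1 + i) = 0 :=
      LinearMap.ext fun u => hpos _ (by omega) u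
    simp [h0]
end
end

section
/- (Weak cocommutativity.) Let (V, Y, c) be a graded vertex coalgebra over F. For every v' ∈ (V^{⊗3})' there exists k ∈ ℤ_+ (depending only on v') such that for every v ∈ V, (x_1−x_2)^k ⟨v', (Id_V ⊗ Y(x_2))Y(x_1)v − (T ⊗ Id_V)(Id_V ⊗ Y(x_1))Y(x_2)v⟩ = 0 as a formal series in x_1, x_2. -/
/- Common background for the formalization of "Vertex coalgebras, comodules,
cocommutativity and coassociativity" (K. Hubbard).

A vertex coalgebra `(V, Y, c)` is encoded by the family of coefficient maps
`Δ k : V →ₗ V ⊗ V` of the coproduct `Y(x)v = ∑ₖ Δ k v · x^(-k-1)` together with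
the covacuum `c : V →ₗ F`.  All identities of formal series are encoded
coefficient-wise; in particular the Jacobi identity is encoded by its
(dual Borcherds) coefficient form. -/

noncomputable section

open scoped TensorProduct

variable (F : Type) [Field F] [CharZero F]

variable {V M : Type} [AddCommGroup V] [Module F V] [AddCommGroup M] [Module F M]

/-- At a natural number the generalized binomial coefficient is the usual one. -/
theorem gchoose_natCast (k i : ℕ) : gchoose F (k : ℤ) i = (k.choose i : F) := by
  have hfac : (Nat.factorial i : F) ≠ 0 := Nat.cast_ne_zero.mpr (Nat.factorial_ne_zero i)
  rw [gchoose, div_eq_iff hfac, mul_comm, ← Nat.cast_mul,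
    ← Nat.descFactorial_eq_factorial_mul_choose]
  rcases le_or_gt i k with h | h
  · rw [Nat.descFactorial_eq_prod_range, Nat.cast_prod]
    refine Finset.prod_congr rfl fun j hj => ?_
    rw [Nat.cast_sub ((Finset.mem_range.mp hj).le.trans h), Int.cast_natCast]
  · rw [Nat.descFactorial_of_lt h, Nat.cast_zero]
    exact Finset.prod_eq_zero (Finset.mem_range.mpr h) (by simp)

set_option linter.unusedSectionVars false in
theorem assoc_tmul_mem_grT3 (gr : ℤ → Submodule F V) {n q : ℤ} {t : V ⊗[F] V}
    (ht : t ∈ grT2 F gr n) {u : V} (hu : u ∈ gr q) :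
    TensorProduct.assoc F V V V (t ⊗ₜ[F] u) ∈ grT3 F gr (n + q) := by
  suffices h : grT2 F gr n ≤ (grT3 F gr (n + q)).comap
      ((TensorProduct.assoc F V V V).toLinearMap ∘ₗ (TensorProduct.mk F (V ⊗[F] V) V).flip u) from
    h ht
  refine iSup_le fun p => ?_
  rintro _ ⟨y, rfl⟩
  induction y using TensorProduct.induction_on with
  | zero => simp
  | add x y hx hy =>
    rw [map_add]
    exact add_mem hx hy
  | tmul x y =>
    refine Submodule.mem_iSup_of_mem (p, n - p) ?_
    have hq : n + q - p - (n - p) = q := by ring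
    exact ⟨x ⊗ₜ (y ⊗ₜ ⟨u, by rw [hq]; exact hu⟩), by simp⟩

set_option linter.unusedSectionVars false in
/-- A functional in the graded dual of `V ⊗ V ⊗ V` kills the image of `Δ m ⊗ Id` for all
sufficiently large `m`. -/
theorem exists_forall_le_comul_map_eq_zero (Δ : ℤ → V →ₗ[F] V ⊗[F] V) (gr : ℤ → Submodule F V)
    (hgr : IsGradedVC F Δ gr) (f : V ⊗[F] (V ⊗[F] V) →ₗ[F] F) (hf : GradedDual3 F gr f) :
    ∃ k : ℕ, 0 < k ∧ ∀ m : ℤ, (k : ℤ) ≤ m → ∀ t : V ⊗[F] V,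
      f (TensorProduct.assoc F V V V (TensorProduct.map (Δ m) LinearMap.id t)) = 0 := by
  obtain ⟨hint, ⟨N, hN⟩, hΔ⟩ := hgr
  obtain ⟨s, hs⟩ := hf
  obtain ⟨S, hS⟩ := s.bddAbove
  refine ⟨(S - 2 * N).toNat + 1, Nat.succ_pos _, fun m hm t => ?_⟩
  have htop (x : V) : x ∈ ⨆ p, gr p := hint.submodule_iSup_eq_top ▸ Submodule.mem_top
  induction t using TensorProduct.induction_on with
  | zero => simp
  | add x y hx hy => simp only [map_add, hx, hy, add_zero]
  | tmul x y =>
    rw [TensorProduct.map_tmul, LinearMap.id_apply]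
    induction htop x using Submodule.iSup_induction' with
    | zero => simp
    | add x x' _ _ hx hx' => simp only [map_add, TensorProduct.add_tmul, hx, hx', add_zero]
    | mem p x hx =>
      induction htop y using Submodule.iSup_induction' with
      | zero => simp
      | add y y' _ _ hy hy' => simp only [map_add, TensorProduct.tmul_add, hy, hy', add_zero]
      | mem q y hy =>
        by_cases hp : p < N
        · rw [hN p hp, Submodule.mem_bot] at hx
          simp [hx]
        by_cases hq : q < N
        · rw [hN q hq, Submodule.mem_bot] at hy
          simp [hy]
        refine hs (p + m + 1 + q) (fun hmem => ?_) _ (assoc_tmul_mem_grT3 F gr (hΔ p m x hx) hy)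
        have : p + m + 1 + q ≤ S := hS hmem
        omega

/-- Weak cocommutativity: For a graded vertex coalgebra `(V, Y, c)`
and every `v'` in the graded dual `(V^{⊗3})'` there exists `k ∈ ℤ₊`, depending
only on `v'`, such that for every `v ∈ V`,
`(x₁-x₂)^k ⟨v', (Id ⊗ Y(x₂))Y(x₁)v - (T ⊗ Id)(Id ⊗ Y(x₁))Y(x₂)v⟩ = 0`. -/
theorem weak_cocommutativity
    (Δ : ℤ → V →ₗ[F] V ⊗[F] V) (c : V →ₗ[F] F) (gr : ℤ → Submodule F V)
    (hVC : IsVertexCoalg F Δ c) (hgr : IsGradedVC F Δ gr)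
    (f : V ⊗[F] (V ⊗[F] V) →ₗ[F] F) (hf : GradedDual3 F gr f) :
    ∃ k : ℕ, 0 < k ∧ WeakCocom F Δ f k := by
  obtain ⟨k, hk, hkill⟩ := exists_forall_le_comul_map_eq_zero F Δ gr hgr f hf
  refine ⟨k, hk, fun w b c => ?_⟩
  have hJ := congrArg f (hVC.2 k b c w)
  have hR : f (∑ᶠ i : ℕ, gchoose F b i • compR F Δ Δ (k + i) (b + c - i) w) = 0 := by
    refine finsum_induction (fun t => f t = 0) (map_zero f)
      (fun x y hx hy => by rw [map_add, hx, hy, add_zero]) fun i => ?_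
    rw [map_smul, compR, LinearMap.comp_apply, LinearMap.comp_apply]
    exact smul_eq_zero_of_right _ (hkill _ (by omega) _)
  rw [hR, finsum_eq_sum_of_support_subset (s := Finset.range (k + 1))] at hJ
  · simp only [gchoose_natCast, map_sum, map_smul, map_sub, smul_eq_mul, mul_sub,
      Finset.sum_sub_distrib, zpow_natCast] at hJ
    rw [← hJ]
    simp only [mul_sub, Finset.sum_sub_distrib]
    congr 1
    · refine Finset.sum_congr rfl fun j _ => ?_
      rw [add_comm b]
    · rw [← Finset.sum_range_reflect]
      refine Finset.sum_congr rfl fun j hj => ?_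
      have hjk : j ≤ k := Nat.lt_succ_iff.mp (Finset.mem_range.mp hj)
      have hsub : k + 1 - 1 - j = k - j := by omega
      have h₁ : c + ((k - j : ℕ) : ℤ) = k + c - j := by omega
      have h₂ : b + k - ((k - j : ℕ) : ℤ) = b + j := by omega
      have hsign : (-1 : F) ^ (k - j) = (-1) ^ j * (-1) ^ k := by
        obtain ⟨d, rfl⟩ := Nat.exists_eq_add_of_le hjk
        rw [Nat.add_sub_cancel_left, pow_add, ← mul_assoc, ← mul_pow]
        simp
      rw [hsub, h₁, h₂, Nat.choose_symm hjk, hsign]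
      ring
  · intro i hi
    rw [Finset.coe_range, Set.mem_Iio]
    by_contra! h
    refine hi ?_
    simp [gchoose_natCast, Nat.choose_eq_zero_of_lt (Nat.lt_of_succ_le h)]
end
end
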